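/- Let E be a finite-dimensional spectral COSEA and a∈S(E). Then there exists a unique state ω∈Ω(E) with ω(a)=1 if and only if a∈S_1(E). -/

import Mathlib

set_option linter.unusedVariables false

universe u v

theorem prod_eq' {α β : Type*} {p q : α × β} (h1 : p.1 = q.1) (h2 : p.2 = q.2) : p = q :=
  Prod.ext_iff.mpr ⟨h1, h2⟩

/-- A convex sequential effect algebra (COSEA).  The partial sum `⊕` is modelled by a
total operation `oplus` together with a definedness predicate `perp`; all axioms only
constrain `oplus` on pairs satisfying `perp`.  The scalar action is modelled by a total
map `smul : ℝ → E → E`, with axioms imposed for scalars in `[0,1]`. -/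
structure COSEA (E : Type u) where
  zero : E
  one : E
  perp : E → E → Prop
  oplus : E → E → E
  compl : E → E
  smul : ℝ → E → E
  seq : E → E → E
  -- effect algebra axioms
  perp_comm : ∀ a b, perp a b → perp b a
  oplus_comm : ∀ a b, perp a b → oplus a b = oplus b a
  perp_assoc_right : ∀ a b c, perp a b → perp (oplus a b) c → perp b c
  perp_assoc_left : ∀ a b c, perp a b → perp (oplus a b) c → perp a (oplus b c)
  oplus_assoc : ∀ a b c, perp a b → perp (oplus a b) c →
    oplus a (oplus b c) = oplus (oplus a b) c
  perp_compl : ∀ a, perp a (compl a)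
  oplus_compl : ∀ a, oplus a (compl a) = one
  compl_unique : ∀ a b, perp a b → oplus a b = one → b = compl a
  perp_one : ∀ a, perp a one → a = zero
  -- convexity axioms
  smul_smul : ∀ α β a, 0 ≤ α → α ≤ 1 → 0 ≤ β → β ≤ 1 →
    smul α (smul β a) = smul (α * β) a
  perp_smul_self : ∀ α β a, 0 ≤ α → 0 ≤ β → α + β ≤ 1 → perp (smul α a) (smul β a)
  add_smul : ∀ α β a, 0 ≤ α → 0 ≤ β → α + β ≤ 1 →
    smul (α + β) a = oplus (smul α a) (smul β a)
  perp_smul : ∀ lam a b, 0 ≤ lam → lam ≤ 1 → perp a b → perp (smul lam a) (smul lam b)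
  smul_oplus : ∀ lam a b, 0 ≤ lam → lam ≤ 1 → perp a b →
    smul lam (oplus a b) = oplus (smul lam a) (smul lam b)
  one_smul : ∀ a, smul 1 a = a
  -- sequential product axioms
  seq_perp : ∀ a b c, perp b c → perp (seq a b) (seq a c)
  seq_oplus : ∀ a b c, perp b c → seq a (oplus b c) = oplus (seq a b) (seq a c)
  one_seq : ∀ a, seq one a = a
  seq_eq_zero_comm : ∀ a b, seq a b = zero → seq b a = seq a b
  comm_compl : ∀ a b, seq a b = seq b a → seq a (compl b) = seq (compl b) a
  comm_assoc : ∀ a b c, seq a b = seq b a → seq a (seq b c) = seq (seq a b) c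
  comm_seq : ∀ a b c, seq c a = seq a c → seq c b = seq b c →
    seq c (seq a b) = seq (seq a b) c
  comm_oplus : ∀ a b c, seq c a = seq a c → seq c b = seq b c → perp a b →
    seq c (oplus a b) = seq (oplus a b) c
  smul_seq : ∀ lam a b, 0 ≤ lam → lam ≤ 1 → seq (smul lam a) b = smul lam (seq a b)
  seq_smul : ∀ lam a b, 0 ≤ lam → lam ≤ 1 → seq a (smul lam b) = smul lam (seq a b)

/-- `SumList C l s` : the orthogonal sum of the list `l` is defined and equals `s`. -/
inductive COSEA.SumList {E : Type u} (C : COSEA E) : List E → E → Prop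
  | nil : COSEA.SumList C [] C.zero
  | cons {a : E} {l : List E} {s : E} :
      COSEA.SumList C l s → C.perp a s → COSEA.SumList C (a :: l) (C.oplus a s)

namespace COSEA

variable {E : Type u}

/-- `a ≤ b` in the effect-algebra order. -/
def le (C : COSEA E) (a b : E) : Prop := ∃ c, C.perp a c ∧ C.oplus a c = b

/-- `a` is sharp: the greatest lower bound of `a` and `a'` is `0`,
i.e. every common lower bound of `a` and `a'` lies below `0`. -/
def IsSharp (C : COSEA E) (a : E) : Prop :=
  ∀ c, C.le c a → C.le c (C.compl a) → C.le c C.zero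

/-- `a` is a one-dimensional (atomic) sharp element. -/
def IsOneDim (C : COSEA E) (a : E) : Prop :=
  C.IsSharp a ∧ a ≠ C.zero ∧
    ∀ b, C.le b a → ∃ lam : ℝ, 0 ≤ lam ∧ lam ≤ 1 ∧ b = C.smul lam a

/-- A state on a COSEA. -/
def IsState (C : COSEA E) (ω : E → ℝ) : Prop :=
  (∀ a, 0 ≤ ω a ∧ ω a ≤ 1) ∧ ω C.one = 1 ∧
    ∀ a b, C.perp a b → ω (C.oplus a b) = ω a + ω b

/-- A context presented as an injective finite enumeration of one-dimensional
elements summing to `1`. -/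
def IsContextFun (C : COSEA E) {n : ℕ} (a : Fin n → E) : Prop :=
  Function.Injective a ∧ (∀ i, C.IsOneDim (a i)) ∧ C.SumList (List.ofFn a) C.one

/-- A context as a set of effects. -/
def IsContext (C : COSEA E) (A : Set E) : Prop :=
  ∃ (n : ℕ) (a : Fin n → E), C.IsContextFun a ∧ Set.range a = A

/-- `E` is finite-dimensional: there is no infinite sequence of one-dimensional
elements all of whose initial partial orthogonal sums are defined. -/
def FinDim (C : COSEA E) : Prop :=
  ¬ ∃ f : ℕ → E, (∀ i, C.IsOneDim (f i)) ∧
      ∀ n : ℕ, ∃ s, C.SumList ((List.range n).map f) s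

/-- `E` is state-unique. -/
def StateUnique (C : COSEA E) : Prop :=
  ∀ a, C.IsOneDim a → ∃! ω : E → ℝ, C.IsState ω ∧ ω a = 1

/-- `E` is symmetric : `â(b) = b̂(a)` for all one-dimensional `a, b`. -/
def Symm (C : COSEA E) : Prop :=
  ∀ a b ω ρ, C.IsOneDim a → C.IsOneDim b → C.IsState ω → C.IsState ρ →
    ω a = 1 → ρ b = 1 → ω b = ρ a

/-- `b = λ₁ a₁ ⊕ ⋯ ⊕ λₙ aₙ` with all `λ i ∈ [0,1]`. -/
def SpanRep (C : COSEA E) {n : ℕ} (a : Fin n → E) (lam : Fin n → ℝ) (b : E) : Prop :=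
  (∀ i, 0 ≤ lam i ∧ lam i ≤ 1) ∧
    C.SumList (List.ofFn fun i => C.smul (lam i) (a i)) b

/-- `b ∈ E(A)` : `b` has a representation over the context `A`. -/
def InSpan (C : COSEA E) (A : Set E) (b : E) : Prop :=
  ∃ (n : ℕ) (a : Fin n → E) (lam : Fin n → ℝ),
    C.IsContextFun a ∧ Set.range a = A ∧ C.SpanRep a lam b

/-- `E` is spectral. -/
def Spectral (C : COSEA E) : Prop :=
  C.StateUnique ∧ ∀ b, ∃ A, C.IsContext A ∧ C.InSpan A b

/-- The commutant of a subset. -/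
def commutant (C : COSEA E) (F : Set E) : Set E :=
  {b | ∀ a ∈ F, C.seq b a = C.seq a b}

/-- The center `E' = {b : b ∘ a = a ∘ b for all a}`. -/
def center (C : COSEA E) : Set E := C.commutant Set.univ

/-- `E` is a factor: the center consists of the effects `λ 1`, `λ ∈ [0,1]`. -/
def IsFactor (C : COSEA E) : Prop :=
  C.center = {b | ∃ lam : ℝ, 0 ≤ lam ∧ lam ≤ 1 ∧ b = C.smul lam C.one}

/-- Sub-COSEA. -/
def IsSubCOSEA (C : COSEA E) (F : Set E) : Prop :=
  C.zero ∈ F ∧ C.one ∈ F ∧ (∀ a ∈ F, C.compl a ∈ F) ∧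
    (∀ lam : ℝ, 0 ≤ lam → lam ≤ 1 → ∀ a ∈ F, C.smul lam a ∈ F) ∧
    (∀ a ∈ F, ∀ b ∈ F, C.perp a b → C.oplus a b ∈ F) ∧
    (∀ a ∈ F, ∀ b ∈ F, C.seq a b ∈ F)

/-- `a` is a minimal sharp element of `F`. -/
def MinSharp (C : COSEA E) (F : Set E) (a : E) : Prop :=
  a ∈ F ∧ C.IsSharp a ∧ a ≠ C.zero ∧
    ∀ b ∈ F, C.IsSharp b → b ≠ C.zero → C.le b a → b = a

/-- COSEA isomorphism. -/
def IsIso {F : Type u} (C : COSEA E) (D : COSEA F) (φ : E → F) : Prop :=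
  Function.Bijective φ ∧ φ C.one = D.one ∧
    (∀ a b, C.perp a b ↔ D.perp (φ a) (φ b)) ∧
    (∀ a b, C.perp a b → φ (C.oplus a b) = D.oplus (φ a) (φ b)) ∧
    (∀ lam : ℝ, 0 ≤ lam → lam ≤ 1 → ∀ a, φ (C.smul lam a) = D.smul lam (φ a)) ∧
    (∀ a b, φ (C.seq a b) = D.seq (φ a) (φ b))

/-- `lam` is an eigenvalue of `b` : `lam = â(b)` for some eigeneffect `a` of `b`. -/
def IsEigenvalue (C : COSEA E) (b : E) (lam : ℝ) : Prop :=
  ∃ (a : E) (ω : E → ℝ), C.IsOneDim a ∧ C.seq a b = C.seq b a ∧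
    C.IsState ω ∧ ω a = 1 ∧ lam = ω b

/-- The spectrum of `b`. -/
def spectrum (C : COSEA E) (b : E) : Set ℝ := {lam | C.IsEigenvalue b lam}

/-- `c = ⌈a⌉` : `c` is the least sharp element dominating `a`. -/
def IsCeil (C : COSEA E) (a c : E) : Prop :=
  C.IsSharp c ∧ C.le a c ∧ ∀ d, C.IsSharp d → C.le a d → C.le c d

/-- `b` is a pseudo-inverse of `a` with scalar `lam` :
`⌈b⌉ = ⌈a⌉`, `‖b‖ = 1` and `a ∘ b = b ∘ a = lam ⌈a⌉`. -/
def IsPseudoInvWith (C : COSEA E) (a b : E) (lam : ℝ) : Prop :=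
  (∃ ca, C.IsCeil a ca ∧ C.IsCeil b ca ∧
    C.seq a b = C.smul lam ca ∧ C.seq b a = C.smul lam ca) ∧
  IsGreatest (C.spectrum b) 1 ∧ 0 ≤ lam ∧ lam ≤ 1

/-- The conditional probability map `γ_a` (zero functionals are sent to `0`). -/
noncomputable def condProb (C : COSEA E) (a : E) (ω : E → ℝ) : E → ℝ :=
  fun c => if ω a = 0 then 0 else ω (C.seq a c) / ω a

/-- Membership in `Ω̂(E) = Ω(E) ∪ {0}`. -/
def InOmegaHat (C : COSEA E) (ω : E → ℝ) : Prop :=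
  C.IsState ω ∨ ω = fun _ => 0

/-- Direct sum of two COSEAs, with all operations componentwise. -/
def prod {E F : Type u} (C : COSEA E) (D : COSEA F) : COSEA (E × F) where
  zero := (C.zero, D.zero)
  one := (C.one, D.one)
  perp a b := C.perp a.1 b.1 ∧ D.perp a.2 b.2
  oplus a b := (C.oplus a.1 b.1, D.oplus a.2 b.2)
  compl a := (C.compl a.1, D.compl a.2)
  smul lam a := (C.smul lam a.1, D.smul lam a.2)
  seq a b := (C.seq a.1 b.1, D.seq a.2 b.2)
  perp_comm := fun a b h => ⟨C.perp_comm _ _ h.1, D.perp_comm _ _ h.2⟩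
  oplus_comm := fun a b h => prod_eq' (C.oplus_comm _ _ h.1) (D.oplus_comm _ _ h.2)
  perp_assoc_right := fun a b c h1 h2 =>
    ⟨C.perp_assoc_right _ _ _ h1.1 h2.1, D.perp_assoc_right _ _ _ h1.2 h2.2⟩
  perp_assoc_left := fun a b c h1 h2 =>
    ⟨C.perp_assoc_left _ _ _ h1.1 h2.1, D.perp_assoc_left _ _ _ h1.2 h2.2⟩
  oplus_assoc := fun a b c h1 h2 =>
    prod_eq' (C.oplus_assoc _ _ _ h1.1 h2.1) (D.oplus_assoc _ _ _ h1.2 h2.2)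
  perp_compl := fun a => ⟨C.perp_compl _, D.perp_compl _⟩
  oplus_compl := fun a => prod_eq' (C.oplus_compl _) (D.oplus_compl _)
  compl_unique := fun a b h he =>
    prod_eq' (C.compl_unique _ _ h.1 (congrArg Prod.fst he))
      (D.compl_unique _ _ h.2 (congrArg Prod.snd he))
  perp_one := fun a h => prod_eq' (C.perp_one _ h.1) (D.perp_one _ h.2)
  smul_smul := fun α β a h1 h2 h3 h4 =>
    prod_eq' (C.smul_smul _ _ _ h1 h2 h3 h4) (D.smul_smul _ _ _ h1 h2 h3 h4)
  perp_smul_self := fun α β a h1 h2 h3 =>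
    ⟨C.perp_smul_self _ _ _ h1 h2 h3, D.perp_smul_self _ _ _ h1 h2 h3⟩
  add_smul := fun α β a h1 h2 h3 =>
    prod_eq' (C.add_smul _ _ _ h1 h2 h3) (D.add_smul _ _ _ h1 h2 h3)
  perp_smul := fun lam a b h1 h2 h =>
    ⟨C.perp_smul _ _ _ h1 h2 h.1, D.perp_smul _ _ _ h1 h2 h.2⟩
  smul_oplus := fun lam a b h1 h2 h =>
    prod_eq' (C.smul_oplus _ _ _ h1 h2 h.1) (D.smul_oplus _ _ _ h1 h2 h.2)
  one_smul := fun a => prod_eq' (C.one_smul _) (D.one_smul _)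
  seq_perp := fun a b c h => ⟨C.seq_perp _ _ _ h.1, D.seq_perp _ _ _ h.2⟩
  seq_oplus := fun a b c h => prod_eq' (C.seq_oplus _ _ _ h.1) (D.seq_oplus _ _ _ h.2)
  one_seq := fun a => prod_eq' (C.one_seq _) (D.one_seq _)
  seq_eq_zero_comm := fun a b h =>
    prod_eq' (C.seq_eq_zero_comm _ _ (congrArg Prod.fst h))
      (D.seq_eq_zero_comm _ _ (congrArg Prod.snd h))
  comm_compl := fun a b h =>
    prod_eq' (C.comm_compl _ _ (congrArg Prod.fst h))
      (D.comm_compl _ _ (congrArg Prod.snd h))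
  comm_assoc := fun a b c h =>
    prod_eq' (C.comm_assoc _ _ _ (congrArg Prod.fst h))
      (D.comm_assoc _ _ _ (congrArg Prod.snd h))
  comm_seq := fun a b c h1 h2 =>
    prod_eq' (C.comm_seq _ _ _ (congrArg Prod.fst h1) (congrArg Prod.fst h2))
      (D.comm_seq _ _ _ (congrArg Prod.snd h1) (congrArg Prod.snd h2))
  comm_oplus := fun a b c h1 h2 hp =>
    prod_eq' (C.comm_oplus _ _ _ (congrArg Prod.fst h1) (congrArg Prod.fst h2) hp.1)
      (D.comm_oplus _ _ _ (congrArg Prod.snd h1) (congrArg Prod.snd h2) hp.2)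
  smul_seq := fun lam a b h1 h2 =>
    prod_eq' (C.smul_seq _ _ _ h1 h2) (D.smul_seq _ _ _ h1 h2)
  seq_smul := fun lam a b h1 h2 =>
    prod_eq' (C.seq_smul _ _ _ h1 h2) (D.seq_smul _ _ _ h1 h2)

/-- Direct sum of a family of COSEAs, with all operations componentwise. -/
def pi {ι : Type v} {E : ι → Type u} (C : ∀ i, COSEA (E i)) : COSEA (∀ i, E i) where
  zero := fun i => (C i).zero
  one := fun i => (C i).one
  perp a b := ∀ i, (C i).perp (a i) (b i)
  oplus a b := fun i => (C i).oplus (a i) (b i)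
  compl a := fun i => (C i).compl (a i)
  smul lam a := fun i => (C i).smul lam (a i)
  seq a b := fun i => (C i).seq (a i) (b i)
  perp_comm := fun a b h i => (C i).perp_comm _ _ (h i)
  oplus_comm := fun a b h => funext fun i => (C i).oplus_comm _ _ (h i)
  perp_assoc_right := fun a b c h1 h2 i => (C i).perp_assoc_right _ _ _ (h1 i) (h2 i)
  perp_assoc_left := fun a b c h1 h2 i => (C i).perp_assoc_left _ _ _ (h1 i) (h2 i)
  oplus_assoc := fun a b c h1 h2 => funext fun i => (C i).oplus_assoc _ _ _ (h1 i) (h2 i)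
  perp_compl := fun a i => (C i).perp_compl _
  oplus_compl := fun a => funext fun i => (C i).oplus_compl _
  compl_unique := fun a b h he =>
    funext fun i => (C i).compl_unique _ _ (h i) (congrFun he i)
  perp_one := fun a h => funext fun i => (C i).perp_one _ (h i)
  smul_smul := fun α β a h1 h2 h3 h4 =>
    funext fun i => (C i).smul_smul _ _ _ h1 h2 h3 h4
  perp_smul_self := fun α β a h1 h2 h3 i => (C i).perp_smul_self _ _ _ h1 h2 h3
  add_smul := fun α β a h1 h2 h3 => funext fun i => (C i).add_smul _ _ _ h1 h2 h3
  perp_smul := fun lam a b h1 h2 h i => (C i).perp_smul _ _ _ h1 h2 (h i)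
  smul_oplus := fun lam a b h1 h2 h =>
    funext fun i => (C i).smul_oplus _ _ _ h1 h2 (h i)
  one_smul := fun a => funext fun i => (C i).one_smul _
  seq_perp := fun a b c h i => (C i).seq_perp _ _ _ (h i)
  seq_oplus := fun a b c h => funext fun i => (C i).seq_oplus _ _ _ (h i)
  one_seq := fun a => funext fun i => (C i).one_seq _
  seq_eq_zero_comm := fun a b h =>
    funext fun i => (C i).seq_eq_zero_comm _ _ (congrFun h i)
  comm_compl := fun a b h => funext fun i => (C i).comm_compl _ _ (congrFun h i)
  comm_assoc := fun a b c h => funext fun i => (C i).comm_assoc _ _ _ (congrFun h i)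
  comm_seq := fun a b c h1 h2 =>
    funext fun i => (C i).comm_seq _ _ _ (congrFun h1 i) (congrFun h2 i)
  comm_oplus := fun a b c h1 h2 hp =>
    funext fun i => (C i).comm_oplus _ _ _ (congrFun h1 i) (congrFun h2 i) (hp i)
  smul_seq := fun lam a b h1 h2 => funext fun i => (C i).smul_seq _ _ _ h1 h2
  seq_smul := fun lam a b h1 h2 => funext fun i => (C i).seq_smul _ _ _ h1 h2

end COSEA
namespace COSEA

variable {E : Type u} (C : COSEA E)

theorem compl_one : C.compl C.one = C.zero :=
  C.perp_one _ (C.perp_comm _ _ (C.perp_compl _))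

theorem compl_compl (a : E) : C.compl (C.compl a) = a := by
  refine (C.compl_unique _ _ (C.perp_comm _ _ (C.perp_compl a)) ?_).symm
  rw [← C.oplus_comm _ _ (C.perp_compl a), C.oplus_compl]

theorem perp_zero_and_oplus_zero (a : E) : C.perp a C.zero ∧ C.oplus a C.zero = a := by
  have h1 := C.perp_compl (C.compl a)
  have h2 : C.oplus (C.compl a) a = C.one := by
    simpa only [C.compl_compl] using C.oplus_compl (C.compl a)
  rw [C.compl_compl] at h1
  have h3 : C.perp (C.oplus (C.compl a) a) C.zero := by
    rw [h2, ← C.compl_one]; exact C.perp_compl _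
  refine ⟨C.perp_assoc_right _ _ _ h1 h3, ?_⟩
  have h4 := C.compl_unique _ _ (C.perp_assoc_left _ _ _ h1 h3) (by
    rw [C.oplus_assoc _ _ _ h1 h3, h2, ← C.compl_one, C.oplus_compl])
  rw [h4, C.compl_compl]

theorem perp_zero (a : E) : C.perp a C.zero := (C.perp_zero_and_oplus_zero a).1

theorem oplus_zero (a : E) : C.oplus a C.zero = a := (C.perp_zero_and_oplus_zero a).2

theorem zero_oplus (a : E) : C.oplus C.zero a = a := by
  rw [← C.oplus_comm _ _ (C.perp_zero a), C.oplus_zero]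

theorem oplus_right_cancel {a b c : E} (hb : C.perp b a) (hc : C.perp c a)
    (h : C.oplus b a = C.oplus c a) : b = c := by
  have key : ∀ x, C.perp x a → C.oplus x a = C.oplus b a →
      x = C.compl (C.oplus a (C.compl (C.oplus b a))) := by
    intro x hx hxb
    have hp : C.perp (C.oplus x a) (C.compl (C.oplus b a)) := by
      rw [hxb]; exact C.perp_compl _
    have hq := C.perp_assoc_left _ _ _ hx hp
    refine C.compl_unique _ _ (C.perp_comm _ _ hq) ?_
    rw [← C.oplus_comm _ _ hq, C.oplus_assoc _ _ _ hx hp, hxb, C.oplus_compl]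
  rw [key c hc h.symm]
  exact key b hb rfl

theorem eq_zero_of_oplus_self {a : E} (ha : C.perp a a) (h : C.oplus a a = a) :
    a = C.zero :=
  C.oplus_right_cancel ha (C.perp_comm _ _ (C.perp_zero a)) (h.trans (C.zero_oplus a).symm)

theorem eq_zero_of_le_zero {a : E} (h : C.le a C.zero) : a = C.zero := by
  obtain ⟨b, hab, h⟩ := h
  have hb : b = C.zero := C.perp_one _ (C.perp_assoc_right a b C.one hab (by
    rw [h]; exact C.perp_comm _ _ (C.perp_zero _)))
  rw [hb, C.oplus_zero] at h
  exact h

theorem le_trans {a b c : E} (hab : C.le a b) (hbc : C.le b c) : C.le a c := by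
  obtain ⟨d, hd, rfl⟩ := hab
  obtain ⟨e, he, rfl⟩ := hbc
  exact ⟨_, C.perp_assoc_left _ _ _ hd he, C.oplus_assoc _ _ _ hd he⟩

theorem oplus_oplus_comm {a b c d : E} (hab : C.perp a b) (hcd : C.perp c d)
    (h : C.perp (C.oplus a b) (C.oplus c d)) :
    C.perp b d ∧ C.perp (C.oplus a c) (C.oplus b d) ∧
      C.oplus (C.oplus a c) (C.oplus b d) = C.oplus (C.oplus a b) (C.oplus c d) := by
  have hb : C.perp b (C.oplus c d) := C.perp_assoc_right _ _ _ hab h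
  have ha : C.perp a (C.oplus b (C.oplus c d)) := C.perp_assoc_left _ _ _ hab h
  have hdc := C.perp_comm _ _ hcd
  have hdcb : C.perp (C.oplus d c) b := by
    rw [← C.oplus_comm _ _ hcd]; exact C.perp_comm _ _ hb
  have hcb : C.perp c b := C.perp_assoc_right _ _ _ hdc hdcb
  have hd : C.perp d (C.oplus c b) := C.perp_assoc_left _ _ _ hdc hdcb
  have hcbd : C.perp (C.oplus c b) d := C.perp_comm _ _ hd
  have hbd : C.perp b d := C.perp_assoc_right _ _ _ hcb hcbd
  have hc : C.perp c (C.oplus b d) := C.perp_assoc_left _ _ _ hcb hcbd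
  have e : C.oplus c (C.oplus b d) = C.oplus b (C.oplus c d) := by
    rw [C.oplus_assoc _ _ _ hcb hcbd, ← C.oplus_comm _ _ hd, C.oplus_assoc _ _ _ hdc hdcb,
      ← C.oplus_comm _ _ hcd, ← C.oplus_comm _ _ hb]
  have hX : C.perp (C.oplus b d) c := C.perp_comm _ _ hc
  have hY : C.perp (C.oplus (C.oplus b d) c) a := by
    rw [C.oplus_comm _ _ hX, e]; exact C.perp_comm _ _ ha
  have hca : C.perp c a := C.perp_assoc_right _ _ _ hX hY
  have hZ := C.perp_assoc_left _ _ _ hX hY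
  refine ⟨hbd, ?_, ?_⟩
  · rw [← C.oplus_comm _ _ hca]; exact C.perp_comm _ _ hZ
  · rw [← C.oplus_comm _ _ hca, ← C.oplus_comm _ _ hZ, C.oplus_assoc _ _ _ hX hY,
      C.oplus_comm _ _ hY, C.oplus_comm _ _ hX, e, C.oplus_assoc _ _ _ hab h]

theorem smul_zero {r : ℝ} (h0 : 0 ≤ r) (h1 : r ≤ 1) : C.smul r C.zero = C.zero := by
  refine C.eq_zero_of_oplus_self (C.perp_smul r _ _ h0 h1 (C.perp_zero _)) ?_
  rw [← C.smul_oplus r _ _ h0 h1 (C.perp_zero _), C.oplus_zero]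

theorem zero_smul (a : E) : C.smul 0 a = C.zero := by
  refine C.eq_zero_of_oplus_self
    (C.perp_smul_self 0 0 a le_rfl le_rfl (by norm_num)) ?_
  rw [← C.add_smul 0 0 a le_rfl le_rfl (by norm_num), add_zero]

theorem smul_le_smul {r s : ℝ} (h0 : 0 ≤ r) (hrs : r ≤ s) (h1 : s ≤ 1) (a : E) :
    C.le (C.smul r a) (C.smul s a) := by
  refine ⟨C.smul (s - r) a, C.perp_smul_self _ _ _ h0 (by linarith) (by linarith), ?_⟩
  rw [← C.add_smul _ _ _ h0 (by linarith) (by linarith), add_sub_cancel]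

theorem eq_zero_of_smul_eq_zero {r : ℝ} {a : E} (h0 : 0 < r) (h1 : r ≤ 1)
    (h : C.smul r a = C.zero) : a = C.zero := by
  obtain ⟨n, hn⟩ := exists_nat_one_div_lt h0
  set q : ℝ := 1 / ((n : ℝ) + 1) with hq
  have hpos : (0 : ℝ) < (n : ℝ) + 1 := by positivity
  have hq0 : 0 < q := by positivity
  have hqn : ((n : ℝ) + 1) * q = 1 := by rw [hq]; field_simp
  have hqa : C.smul q a = C.zero := by
    refine C.eq_zero_of_le_zero ?_
    rw [← h]
    exact C.smul_le_smul hq0.le hn.le h1 a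
  have key : ∀ k : ℕ, k ≤ n + 1 → C.smul (k * q) a = C.zero := by
    intro k
    induction k with
    | zero => intro _; rw [Nat.cast_zero, zero_mul, C.zero_smul]
    | succ k ih =>
      intro hk
      have hk' : ((k : ℝ) + 1) ≤ (n : ℝ) + 1 := by exact_mod_cast hk
      rw [Nat.cast_succ, add_mul, one_mul, C.add_smul _ _ _ (by positivity) hq0.le
        (by nlinarith), ih (by omega), hqa, C.oplus_zero]
  have h2 := key (n + 1) le_rfl
  rw [Nat.cast_succ, hqn, C.one_smul] at h2
  exact h2

variable {C}

theorem IsState.map_zero {ω : E → ℝ} (hω : C.IsState ω) : ω C.zero = 0 := by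
  have h := hω.2.2 _ _ (C.perp_zero C.zero)
  rw [C.oplus_zero] at h
  linarith

theorem IsState.mono {ω : E → ℝ} (hω : C.IsState ω) {a b : E} (h : C.le a b) :
    ω a ≤ ω b := by
  obtain ⟨c, hc, rfl⟩ := h
  rw [hω.2.2 _ _ hc]
  linarith [(hω.1 c).1]

theorem SumList.le_of_mem {l : List E} {s : E} (h : C.SumList l s) {x : E} (hx : x ∈ l) :
    C.le x s := by
  induction h with
  | nil => simp at hx
  | cons hs hp ih =>
    rcases List.mem_cons.mp hx with rfl | hx
    · exact ⟨_, hp, rfl⟩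
    · exact C.le_trans (ih hx) ⟨_, C.perp_comm _ _ hp, (C.oplus_comm _ _ hp).symm⟩

/-- The complement, within `⊕ aᵢ`, of `⊕ λᵢ aᵢ` is `⊕ (1 - λᵢ) aᵢ`. -/
theorem SumList.exists_complement {n : ℕ} {a : Fin n → E} {r : Fin n → ℝ} {s u : E}
    (hr : ∀ i, 0 ≤ r i ∧ r i ≤ 1) (hu : C.SumList (List.ofFn a) u)
    (hs : C.SumList (List.ofFn fun i => C.smul (r i) (a i)) s) :
    ∃ t, C.SumList (List.ofFn fun i => C.smul (1 - r i) (a i)) t ∧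
      C.perp s t ∧ C.oplus s t = u := by
  induction n generalizing s u with
  | zero =>
    rw [List.ofFn_zero] at hu hs
    cases hu
    cases hs
    exact ⟨C.zero, by rw [List.ofFn_zero]; exact .nil, C.perp_zero _, C.oplus_zero _⟩
  | succ n ih =>
    rw [List.ofFn_succ] at hu hs
    cases hu with
    | cons hu hpu =>
    cases hs with
    | cons hs hps =>
    obtain ⟨t, ht, hst, rfl⟩ := ih (fun i => hr i.succ) hu hs
    obtain ⟨h0, h1⟩ := hr 0
    have hself := C.perp_smul_self (r 0) (1 - r 0) (a 0) h0 (by linarith) (by linarith)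
    have hsum : C.oplus (C.smul (r 0) (a 0)) (C.smul (1 - r 0) (a 0)) = a 0 := by
      rw [← C.add_smul _ _ _ h0 (by linarith) (by linarith), add_sub_cancel, C.one_smul]
    rw [← hsum] at hpu
    obtain ⟨hp, hp', he⟩ := C.oplus_oplus_comm hself hst hpu
    refine ⟨_, ?_, hp', he.trans (by rw [hsum])⟩
    rw [List.ofFn_succ]
    exact .cons ht hp

/-- If a sharp element is a combination over a context, the coefficients are `0` or `1`. -/
theorem IsSharp.coeff_eq_zero_or_one {n : ℕ} {a : Fin n → E} {r : Fin n → ℝ} {b : E}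
    (hb : C.IsSharp b) (ha : C.IsContextFun a) (hr : C.SpanRep a r b) (i : Fin n) :
    r i = 0 ∨ r i = 1 := by
  by_contra! hne
  obtain ⟨h0, h1⟩ := hr.1 i
  have h0 : 0 < r i := lt_of_le_of_ne h0 hne.1.symm
  have h1 : r i < 1 := lt_of_le_of_ne h1 hne.2
  obtain ⟨t, ht, hbt, hone⟩ := SumList.exists_complement hr.1 ha.2.2 hr.2
  obtain rfl : t = C.compl b := C.compl_unique _ _ hbt hone
  have hm0 : 0 < min (r i) (1 - r i) := lt_min h0 (by linarith)
  have hzero : C.smul (min (r i) (1 - r i)) (a i) = C.zero :=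
    C.eq_zero_of_le_zero <| hb _
      (C.le_trans (C.smul_le_smul hm0.le (min_le_left _ _) h1.le _)
        (hr.2.le_of_mem (List.mem_ofFn.mpr ⟨i, rfl⟩)))
      (C.le_trans (C.smul_le_smul hm0.le (min_le_right _ _) (by linarith) _)
        (ht.le_of_mem (List.mem_ofFn.mpr ⟨i, rfl⟩)))
  exact (ha.2.1 i).2.1
    (C.eq_zero_of_smul_eq_zero hm0 ((min_le_left _ _).trans h1.le) hzero)

/-- A sum of elements each of which is zero or one-dimensional with probability one in a
fixed state has at most one nonzero term. -/
theorem SumList.eq_zero_or_isOneDim {ω : E → ℝ} (hω : C.IsState ω) {l : List E} {s : E}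
    (h : C.SumList l s) (hl : ∀ x ∈ l, x = C.zero ∨ C.IsOneDim x ∧ ω x = 1) :
    s = C.zero ∨ C.IsOneDim s ∧ ω s = 1 := by
  induction h with
  | nil => exact .inl rfl
  | @cons x l s hs hp ih =>
    have ih := ih fun y hy => hl y (List.mem_cons_of_mem _ hy)
    rcases hl x List.mem_cons_self with rfl | hx
    · rwa [C.zero_oplus]
    · rcases ih with rfl | ih
      · rw [C.oplus_zero]; exact .inr hx
      · have hadd := hω.2.2 _ _ hp
        linarith [(hω.1 (C.oplus x s)).2, hx.2, ih.2]

end COSEA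

/-- a sharp effect has a unique state giving it probability 1 iff
it is one-dimensional. -/
theorem sharp_unique_state_iff_oneDim {E : Type u} (C : COSEA E)
    (hFD : C.FinDim) (hSp : C.Spectral) (a : E) (ha : C.IsSharp a) :
    (∃! ω : E → ℝ, C.IsState ω ∧ ω a = 1) ↔ C.IsOneDim a := by
  refine ⟨?_, hSp.1 a⟩
  rintro ⟨ω, ⟨hω, hωa⟩, huniq⟩
  obtain ⟨A, -, n, x, r, hx, -, hr⟩ := hSp.2 a
  have hterm : ∀ y ∈ List.ofFn (fun i => C.smul (r i) (x i)),
      y = C.zero ∨ C.IsOneDim y ∧ ω y = 1 := by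
    intro y hy
    have hya := hr.2.le_of_mem hy
    obtain ⟨i, rfl⟩ := List.mem_ofFn.mp hy
    rcases ha.coeff_eq_zero_or_one hx hr i with hi | hi
    · exact .inl (by simp only [hi, C.zero_smul])
    · simp only [hi, C.one_smul] at hya ⊢
      obtain ⟨ρ, ⟨hρ, hρx⟩, -⟩ := hSp.1 _ (hx.2.1 i)
      have hρa : ρ a = 1 := le_antisymm (hρ.1 a).2 (hρx ▸ hρ.mono hya)
      obtain rfl := huniq ρ ⟨hρ, hρa⟩
      exact .inr ⟨hx.2.1 i, hρx⟩
  rcases hr.2.eq_zero_or_isOneDim hω hterm with h | h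
  · rw [h, hω.map_zero] at hωa
    exact absurd hωa zero_ne_one
  · exact h.1
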